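/- Let G = (V, E, s) be a graph in which every node is reachable from s. For every node a ∈ V and every j with 0 ≤ j ≤ k_a, the set {a} ∪ ⋃_{i=1}^{j} D(S^a_i) is a module of G with source a. -/

import Mathlib

open Relation

variable {V : Type*}

/-- `p` is a path from `a` to `b` in the arc relation `E`:
a nonempty list of nodes starting at `a`, ending at `b`,
in which every consecutive pair of nodes is an arc. -/
def IsPath (E : V → V → Prop) (a b : V) (p : List V) : Prop :=
  p ≠ [] ∧ p.head? = some a ∧ p.getLast? = some b ∧ p.Chain' E

/-- `a` dominates `b` (written `a ≥_s b`): every path from `s` to `b` contains `a`. -/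
def Dom (E : V → V → Prop) (s a b : V) : Prop :=
  ∀ p : List V, IsPath E s b p → a ∈ p

/-- `m` is a source of module `M`: `m ∈ M`, every arc entering `M` from outside goes
to `m`, and (convention) if `s ∈ M` then `m = s`. -/
def ModuleSource (E : V → V → Prop) (s : V) (M : Set V) (m : V) : Prop :=
  m ∈ M ∧ (∀ u v, E u v → u ∉ M → v ∈ M → v = m) ∧ (s ∈ M → m = s)

/-- `M` is a module of the graph `(V, E, s)`. -/
def IsModule (E : V → V → Prop) (s : V) (M : Set V) : Prop :=
  ∃ m, ModuleSource E s M m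

/-- Two sets overlap: they intersect but neither contains the other. -/
def Overlap (M H : Set V) : Prop :=
  (M ∩ H).Nonempty ∧ ¬ M ⊆ H ∧ ¬ H ⊆ M

/-- A nesting decomposition: a collection of pairwise non-overlapping modules
containing the trivial modules (the whole node set and all singletons). -/
def IsNestingDecomp (E : V → V → Prop) (s : V) (F : Set (Set V)) : Prop :=
  (∀ M ∈ F, IsModule E s M) ∧
  (∀ M ∈ F, ∀ H ∈ F, ¬ Overlap M H) ∧
  (Set.univ : Set V) ∈ F ∧
  (∀ v : V, ({v} : Set V) ∈ F)

/-- The maximal module partition of `M` within the family `F`. -/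
def MaxPartition (F : Set (Set V)) (M : Set V) : Set (Set V) :=
  {H | H ∈ F ∧ H ⊂ M ∧ ¬ ∃ K ∈ F, H ⊂ K ∧ K ⊂ M}

/-- The width of a nesting decomposition `F`. -/
noncomputable def NDWidth (F : Set (Set V)) : ℕ :=
  ⨆ M ∈ F, (MaxPartition F M).ncard

/-- The nesting width of the graph `(V, E, s)`. -/
noncomputable def nestingWidth (E : V → V → Prop) (s : V) : ℕ :=
  sInf {w : ℕ | ∃ F : Set (Set V), IsNestingDecomp E s F ∧ NDWidth F = w}

/-- `D(a)`: the set of nodes dominated by `a`. -/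
def DomSet (E : V → V → Prop) (s a : V) : Set V := {v | Dom E s a v}

/-- `v` is a child of `a` in the dominator tree. -/
def IsChild (E : V → V → Prop) (s a v : V) : Prop :=
  v ≠ a ∧ Dom E s a v ∧ ∀ b, b ≠ a → b ≠ v → ¬(Dom E s a b ∧ Dom E s b v)

/-- `C(a)`: the set of children of `a` in the dominator tree. -/
def Children (E : V → V → Prop) (s a : V) : Set V := {v | IsChild E s a v}

/-- The arc relation of the graph `G_a` on the children of `a`. -/
def GArc (E : V → V → Prop) (s a : V) (u v : V) : Prop :=
  u ∈ Children E s a ∧ v ∈ Children E s a ∧ u ≠ v ∧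
    ∃ x y, E x y ∧ x ∈ DomSet E s u ∧ y ∈ DomSet E s v

/-- `S` is a strongly connected component of `G_a`
(an equivalence class of mutual reachability in `G_a`). -/
def IsSCC (E : V → V → Prop) (s a : V) (S : Set V) : Prop :=
  ∃ u ∈ Children E s a,
    S = {v | v ∈ Children E s a ∧ ReflTransGen (GArc E s a) u v ∧
          ReflTransGen (GArc E s a) v u}

/-- `L` lists the strongly connected components of `G_a` in topological order:
each member is an SCC of `G_a`, every child of `a` lies in exactly one listed
component, and every arc of `G_a` goes from an earlier component to the same
or a later component. -/
def IsTopoSCCList (E : V → V → Prop) (s a : V) (L : List (Set V)) : Prop :=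
  (∀ S ∈ L, IsSCC E s a S) ∧
  (∀ v ∈ Children E s a, ∃! i : Fin L.length, v ∈ L.get i) ∧
  (∀ i j : Fin L.length, ∀ u ∈ L.get i, ∀ v ∈ L.get j, GArc E s a u v → i ≤ j)

/-- `D(S) = ⋃_{v ∈ S} D(v)`. -/
def DSet (E : V → V → Prop) (s : V) (S : Set V) : Set V := ⋃ v ∈ S, DomSet E s v

/-- The set `{a} ∪ ⋃_{i=1}^{j} D(S^a_i)` (components indexed from 0 in the list). -/
def PrefixModule (E : V → V → Prop) (s a : V) (L : List (Set V)) (j : ℕ) : Set V :=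
  {a} ∪ ⋃ i ∈ Finset.range j, DSet E s (L.getD i ∅)

/-- The A-C family determined by a choice `L` of topologically ordered SCC lists. -/
def ACFamily (E : V → V → Prop) (s : V) (L : V → List (Set V)) : Set (Set V) :=
  {M | ∃ (a : V) (j : ℕ), j ≤ (L a).length ∧ M = PrefixModule E s a (L a) j}

/-- The quantity `max { |S^a_i| : a ∈ V, 1 ≤ i ≤ k_a }`. -/
noncomputable def MaxSCCSize (L : V → List (Set V)) : ℕ :=
  ⨆ a : V, ⨆ i ∈ Finset.range (L a).length, ((L a).getD i ∅).ncard

theorem IsPath.exists_prefix {E : V → V → Prop} {s b c : V} {p : List V}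
    (hp : IsPath E s c p) (hb : b ∈ p) :
    ∃ q, IsPath E s b q ∧ q <+: p ∧ (b ≠ c → q.length < p.length) := by
  obtain ⟨l, r, rfl⟩ := List.append_of_mem hb
  obtain ⟨-, hhead, hlast, hchain⟩ := hp
  have hpre : l ++ [b] <+: l ++ b :: r := ⟨r, by simp⟩
  refine ⟨l ++ [b], ⟨by simp, ?_, by simp, hchain.prefix hpre⟩, hpre, fun hbc => ?_⟩
  · cases l <;> simpa using hhead
  · cases r with
    | nil => simp at hlast; exact absurd hlast hbc
    | cons x r => simp

theorem IsPath.concat {E : V → V → Prop} {s u v : V} {p : List V}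
    (hp : IsPath E s u p) (huv : E u v) : IsPath E s v (p ++ [v]) := by
  obtain ⟨hne, hhead, hlast, hchain⟩ := hp
  refine ⟨by simp, by simp [List.head?_append, hhead], by simp,
    List.isChain_append.2 ⟨hchain, by simp, ?_⟩⟩
  intro x hx y hy
  simp_all

theorem Dom.refl (E : V → V → Prop) (s a : V) : Dom E s a a :=
  fun _ hp => List.mem_of_getLast? hp.2.2.1

theorem Dom.trans {E : V → V → Prop} {s a b c : V}
    (hab : Dom E s a b) (hbc : Dom E s b c) : Dom E s a c := by
  intro p hp
  obtain ⟨q, hq, hqp, -⟩ := hp.exists_prefix (hbc p hp)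
  exact hqp.subset (hab q hq)

theorem Dom.eq_source {E : V → V → Prop} {s a : V}
    (h : Dom E s a s) : a = s := by
  simpa using h [s] ⟨by simp, by simp, by simp, List.isChain_singleton s⟩

/-- A strict dominator of the head of an arc dominates its tail. -/
theorem Dom.of_arc {E : V → V → Prop} {s c u v : V}
    (h : Dom E s c v) (hcv : c ≠ v) (huv : E u v) : Dom E s c u := by
  intro p hp
  simpa [hcv] using h _ (hp.concat huv)

/-- A node strictly dominated by `a` is dominated by some child of `a`. -/
theorem Dom.exists_child {E : V → V → Prop} {s a u : V} {p : List V}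
    (hp : IsPath E s u p) (h : Dom E s a u) (hua : u ≠ a) :
    ∃ c ∈ Children E s a, Dom E s c u := by
  induction hn : p.length using Nat.strong_induction_on generalizing u p with
  | _ n ih =>
    by_cases hc : IsChild E s a u
    · exact ⟨u, hc, Dom.refl E s u⟩
    · simp only [IsChild, not_and, not_forall, not_not] at hc
      obtain ⟨b, hba, hbu, hab, hdom⟩ := hc hua h
      obtain ⟨q, hq, -, hlt⟩ := hp.exists_prefix (hdom p hp)
      obtain ⟨c, hc, hcb⟩ := ih q.length (hn ▸ hlt hbu) hq hab hba rfl
      exact ⟨c, hc, hcb.trans hdom⟩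

theorem mem_prefixModule_iff {E : V → V → Prop} {s a v : V}
    {L : List (Set V)} {j : ℕ} (hj : j ≤ L.length) :
    v ∈ PrefixModule E s a L j ↔
      v = a ∨ ∃ i : Fin L.length, (i : ℕ) < j ∧ ∃ c ∈ L.get i, Dom E s c v := by
  simp only [PrefixModule, DSet, DomSet, Set.mem_union, Set.mem_singleton_iff, Set.mem_iUnion,
    Finset.mem_range, Set.mem_ofPred_eq, exists_prop]
  refine or_congr_right ⟨?_, ?_⟩
  · rintro ⟨i, hi, c, hc, hcv⟩
    rw [List.getD_eq_getElem _ _ (hi.trans_le hj)] at hc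
    exact ⟨⟨i, hi.trans_le hj⟩, hi, c, hc, hcv⟩
  · rintro ⟨i, hi, c, hc, hcv⟩
    refine ⟨i, hi, c, ?_, hcv⟩
    rwa [List.getD_eq_getElem _ _ i.isLt]

theorem IsSCC.subset_children {E : V → V → Prop} {s a : V} {S : Set V}
    (hS : IsSCC E s a S) : S ⊆ Children E s a := by
  obtain ⟨u, -, rfl⟩ := hS
  exact fun _ hv => hv.1

/-- for every node `a` and every `0 ≤ j ≤ k_a`, the set
`{a} ∪ ⋃_{i=1}^{j} D(S^a_i)` is a module with source `a`. -/
theorem prefixModule_is_module [Fintype V] (E : V → V → Prop) (s : V)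
    (hreach : ∀ v : V, ∃ p : List V, IsPath E s v p)
    (a : V) (L : List (Set V)) (hL : IsTopoSCCList E s a L)
    (j : ℕ) (hj : j ≤ L.length) :
    ModuleSource E s (PrefixModule E s a L j) a := by
  obtain ⟨hscc, hcover, htopo⟩ := hL
  have hchild (i : Fin L.length) : L.get i ⊆ Children E s a :=
    (hscc _ (L.get_mem i)).subset_children
  refine ⟨(mem_prefixModule_iff hj).2 (Or.inl rfl), fun u v huv hu hv => ?_, fun hs => ?_⟩
  · by_contra hva
    rw [mem_prefixModule_iff hj] at hu hv
    push Not at hu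
    obtain ⟨hua, hu⟩ := hu
    obtain ⟨i, hi, c, hc, hcv⟩ := hv.resolve_left hva
    have hac : Dom E s a c := (hchild i hc).2.1
    by_cases hcv' : c = v
    · subst hcv'
      obtain ⟨p, hp⟩ := hreach u
      obtain ⟨d, hd, hdu⟩ := Dom.exists_child hp (hac.of_arc (Ne.symm hva) huv) hua
      have hdc : d ≠ c := by
        rintro rfl
        exact hu i hi d hc hdu
      obtain ⟨k, hk, -⟩ := hcover d hd
      have hki : k ≤ i :=
        htopo k i d hk c hc ⟨hd, hchild i hc, hdc, u, c, huv, hdu, Dom.refl E s c⟩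
      exact hu k (lt_of_le_of_lt hki hi) d hk hdu
    · exact hu i hi c hc (hcv.of_arc hcv' huv)
  · obtain rfl | ⟨i, -, c, hc, hcs⟩ := (mem_prefixModule_iff hj).1 hs
    · rfl
    · exact ((hchild i hc).2.1.trans hcs).eq_source
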